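/- Let ε = 1 or ε = −1, b ∈ ℝ with εb > 0, a ∈ ℂ, and let S ⊆ ℂ ∖ {0} be open. Let u : ℂ → ℂ be analytic on S with u(τ) ≠ 0 for all τ ∈ S, and suppose u satisfies the degenerate third Painlevé equation dP3(a, ε, b) on S. Define u₊(τ) := −(iεb/(8·u(τ)²))·(τ·(u'(τ) + ib) + (2ai − 1)·u(τ)), and assume u₊(τ) ≠ 0 for all τ ∈ S. Then u₊ is analytic on S and satisfies dP3(a + i, ε, b) on S, i.e., u₊''(τ) = (u₊'(τ))²/u₊(τ) − u₊'(τ)/τ + (−8ε·u₊(τ)² + 2(a+i)b)/τ + b²/u₊(τ) for all τ ∈ S. -/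

import Mathlib

open Complex

/-- The degenerate third Painlevé equation `dP3(a, ε, b)` at the point `τ`. -/
def IsDP3At (a : ℂ) (ε b : ℝ) (u : ℂ → ℂ) (τ : ℂ) : Prop :=
  deriv (deriv u) τ =
    (deriv u τ) ^ 2 / u τ - deriv u τ / τ +
      (-8 * (ε : ℂ) * (u τ) ^ 2 + 2 * a * (b : ℂ)) / τ + (b : ℂ) ^ 2 / u τ

/-- The elimination step behind the Bäcklund transformation: a solution of the first-order system
relating `u` and `v` gives the second-order equation for `v`, in cleared form. -/
theorem dp3_of_first_order_system {a b e t u p v q s : ℂ} (hb : b ≠ 0) (ht : t ≠ 0)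
    (h₁ : b * t * p = 8 * I * e * v * u ^ 2 - I * b ^ 2 * t - b * (2 * a * I - 1) * u)
    (h₂ : b * t * q = I * b ^ 2 * t - 8 * I * e * u * v ^ 2 + b * (2 * a * I - 1) * v)
    (h₃ : b * q + b * t * s = I * b ^ 2 - 8 * I * e * (p * v ^ 2 + 2 * u * v * q)
      + b * (2 * a * I - 1) * q) :
    s * t * v = q ^ 2 * t - q * v + (-8 * e * v ^ 2 + 2 * (a + I) * b) * v + b ^ 2 * t := by
  refine mul_left_cancel₀ (mul_ne_zero (pow_ne_zero 2 hb) ht) ?_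
  linear_combination b * t * v * h₃ - 8 * I * e * v ^ 3 * h₁
    - (8 * I * e * u * v ^ 2 + I * b ^ 2 * t + b * t * q) * h₂
    + (8 * e * b ^ 2 * t * v ^ 3 - b ^ 4 * t ^ 2 - 2 * a * b ^ 3 * t * v) * I_sq

/-- The cleared form of `dP3` implies `dP3` away from zeros of `u`. -/
theorem IsDP3At.of_mul_eq {a : ℂ} {ε b : ℝ} {u : ℂ → ℂ} {t : ℂ} (ht : t ≠ 0) (hu : u t ≠ 0)
    (h : deriv (deriv u) t * t * u t = deriv u t ^ 2 * t - deriv u t * u t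
      + (-8 * ε * u t ^ 2 + 2 * a * b) * u t + b ^ 2 * t) :
    IsDP3At a ε b u t := by
  unfold IsDP3At
  field_simp
  linear_combination h

/-- The Bäcklund transformation (2.3): if `u` solves `dP3(a, ε, b)` on an open set
`S ⊆ ℂ ∖ {0}`, then `u₊` is analytic on `S` and solves `dP3(a + i, ε, b)` there. -/
theorem backlund_transformation
    (ε b : ℝ) (hε : ε = 1 ∨ ε = -1) (hεb : ε * b > 0) (a : ℂ)
    (S : Set ℂ) (hS : IsOpen S) (hS0 : S ⊆ {(0 : ℂ)}ᶜ)
    (u : ℂ → ℂ)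
    (hu : ∀ τ ∈ S, AnalyticAt ℂ u τ)
    (hune : ∀ τ ∈ S, u τ ≠ 0)
    (heq : ∀ τ ∈ S, IsDP3At a ε b u τ)
    (up : ℂ → ℂ)
    (hup : ∀ τ, up τ = -(I * (ε : ℂ) * (b : ℂ) / (8 * (u τ) ^ 2)) *
      (τ * (deriv u τ + I * (b : ℂ)) + (2 * a * I - 1) * u τ))
    (hupne : ∀ τ ∈ S, up τ ≠ 0) :
    (∀ τ ∈ S, AnalyticAt ℂ up τ) ∧ (∀ τ ∈ S, IsDP3At (a + I) ε b up τ) := by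
  have hb : (b : ℂ) ≠ 0 := by
    rintro h
    simp [ofReal_eq_zero.mp h] at hεb
  have hε2 : (ε : ℂ) ^ 2 = 1 := by
    rcases hε with rfl | rfl <;> norm_num
  have hup' : up = fun τ => -(I * (ε : ℂ) * (b : ℂ) / (8 * (u τ) ^ 2)) *
      (τ * (deriv u τ + I * (b : ℂ)) + (2 * a * I - 1) * u τ) := funext hup
  have han : ∀ τ ∈ S, AnalyticAt ℂ up τ := by
    intro τ hτ
    have h₀ := hu τ hτ
    have h₁ := h₀.deriv
    rw [hup']
    exact ((analyticAt_const.div (analyticAt_const.mul (h₀.pow 2))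
      (mul_ne_zero (by norm_num) (pow_ne_zero 2 (hune τ hτ)))).neg).mul
      ((analyticAt_id.mul (h₁.add analyticAt_const)).add (analyticAt_const.mul h₀))
  have hsys₁ : ∀ τ ∈ S, b * τ * deriv u τ =
      8 * I * ε * up τ * u τ ^ 2 - I * b ^ 2 * τ - b * (2 * a * I - 1) * u τ := by
    intro τ hτ
    have hu0 := hune τ hτ
    rw [hup τ]
    field_simp
    linear_combination ((ε : ℂ) ^ 2 * (τ * (deriv u τ + I * b) + (2 * a * I - 1) * u τ)) * I_sq
      - (τ * (deriv u τ + I * b) + (2 * a * I - 1) * u τ) * hε2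
  have hsys₂ : ∀ τ ∈ S, b * τ * deriv up τ =
      I * b ^ 2 * τ - 8 * I * ε * u τ * up τ ^ 2 + b * (2 * a * I - 1) * up τ := by
    intro τ hτ
    have hu0 := hune τ hτ
    have hτ0 : τ ≠ 0 := hS0 hτ
    have h₀ := (hu τ hτ).differentiableAt.hasDerivAt
    have h₁ := (hu τ hτ).deriv.differentiableAt.hasDerivAt
    have hv := (han τ hτ).differentiableAt.hasDerivAt
    -- differentiate `8 u² u₊ = -iεb (τ (u' + ib) + (2ai - 1) u)`
    have hL := ((h₀.pow 2).const_mul 8).mul hv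
    have hR := (((hasDerivAt_id τ).mul (h₁.add_const (I * (b : ℂ)))).add
      (h₀.const_mul (2 * a * I - 1))).const_mul (-(I * ε * b))
    have hLR := hL.unique (hR.congr_of_eventuallyEq (by
      filter_upwards [hS.mem_nhds hτ] with t ht
      have := hune t ht
      simp only [Pi.mul_apply, Pi.add_apply, Pi.pow_apply, id]
      rw [hup t]
      field_simp))
    have hd := heq τ hτ
    have hs := hsys₁ τ hτ
    unfold IsDP3At at hd
    rw [hd] at hLR
    simp only [Pi.pow_apply, id] at hLR
    field_simp at hLR
    norm_num at hLR
    have key : u τ * deriv up τ = I * b * u τ - (deriv u τ + I * b) * up τ := by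
      have hw := hup τ
      field_simp at hw
      refine mul_left_cancel₀ (mul_ne_zero (by norm_num : (8 : ℂ) ≠ 0) (pow_ne_zero 2 hu0)) ?_
      linear_combination hLR + (I * b - deriv u τ) * hw + 8 * I * b * u τ ^ 3 * hε2
        - I * ε * b ^ 2 * (2 * a * u τ + b * τ) * I_sq
    refine mul_left_cancel₀ hu0 ?_
    linear_combination b * τ * key - up τ * hs
  refine ⟨han, fun τ hτ => ?_⟩
  have hτ0 : τ ≠ 0 := hS0 hτ
  refine IsDP3At.of_mul_eq hτ0 (hupne τ hτ)
    (dp3_of_first_order_system hb hτ0 (hsys₁ τ hτ) (hsys₂ τ hτ) ?_)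
  have h₀ := (hu τ hτ).differentiableAt.hasDerivAt
  have hv := (han τ hτ).differentiableAt.hasDerivAt
  have hv' := (han τ hτ).deriv.differentiableAt.hasDerivAt
  have hL := ((hasDerivAt_id τ).const_mul (b : ℂ)).mul hv'
  have hR := (((hasDerivAt_id τ).const_mul (I * (b : ℂ) ^ 2)).sub
    ((h₀.const_mul (8 * I * ε)).mul (hv.pow 2))).add (hv.const_mul (b * (2 * a * I - 1)))
  have hLR := hL.unique (hR.congr_of_eventuallyEq (by
    filter_upwards [hS.mem_nhds hτ] with t ht
    simpa using hsys₂ t ht))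
  simp only [Pi.pow_apply, id] at hLR
  norm_num at hLR
  linear_combination hLR
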